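/- Let ε > 0, t₀ ∈ ℝ, T > 0, and let (x(·,t), y(t)), t ∈ [t₀, t₀+T), be a classical solution of the coupled parabolic ODE–PDE system: for each t, z ↦ x(z,t) is twice continuously differentiable with x(0,t) = x(l,t) = 0, t ↦ x(z,t) and t ↦ y(t) are continuously differentiable, and ∂_t x(z,t) = a² ∂_zz x(z,t) + Φ(x(z,t)) + B(z) y(t) + d₁₁(z,t), ẏ(t) = c² y(t) + ∫₀ˡ D(z) x(z,t) dz + d₁₂(t), where d₁₁(·,t) is continuous for each t and 𝔡 := sup_{t ∈ [t₀,t₀+T)} (‖d₁₁(·,t)‖²_{L²} + d₁₂(t)²)^{1/2} < ∞. Let Ã₀ be the symmetric 2×2 matrix with diagonal entries −2π²a²/l², 2c² and off-diagonal entries ‖B+D‖_{L²}, and set λ := λ_max(Ã₀) + ε. Then for all t ∈ [t₀, t₀+T): (‖x(·,t)‖²_{L²} + y(t)²)^{1/2} ≤ e^{λT/2}·(‖x(·,t₀)‖²_{L²} + y(t₀)²)^{1/2} + ((e^{λT} − 1)/(ε·λ))^{1/2}·𝔡; in particular the quantity (‖x(·,t)‖²_{L²} + y(t)²)^{1/2}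 is bounded on [t₀, t₀+T) by a constant depending only on the initial data, T and 𝔡. -/

import Mathlib

open Set Real

/-- `‖f‖_{L²}` on `[0,l]`. -/
noncomputable def L2norm (l : ℝ) (f : ℝ → ℝ) : ℝ :=
  Real.sqrt (∫ z in (0:ℝ)..l, (f z)^2)

/-- Largest eigenvalue of the symmetric 2×2 matrix `[[p, b], [b, q]]`. -/
noncomputable def lamMax2 (p q b : ℝ) : ℝ :=
  ((p + q) + Real.sqrt ((p - q)^2 + 4 * b^2)) / 2

section

open MeasureTheory intervalIntegral

/-- Cauchy–Schwarz inequality for continuous functions on `[a, b]`. -/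
theorem abs_integral_mul_le_sqrt_mul_sqrt {f g : ℝ → ℝ} {a b : ℝ} (hab : a ≤ b)
    (hf : ContinuousOn f (Icc a b)) (hg : ContinuousOn g (Icc a b)) :
    |∫ z in a..b, f z * g z| ≤ √(∫ z in a..b, f z ^ 2) * √(∫ z in a..b, g z ^ 2) := by
  have hff : IntervalIntegrable (fun z => f z ^ 2) volume a b :=
    (hf.pow 2).intervalIntegrable_of_Icc hab
  have hgg : IntervalIntegrable (fun z => g z ^ 2) volume a b :=
    (hg.pow 2).intervalIntegrable_of_Icc hab
  have hfg : IntervalIntegrable (fun z => f z * g z) volume a b :=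
    (hf.mul hg).intervalIntegrable_of_Icc hab
  have hquad : ∀ s : ℝ, 0 ≤ (∫ z in a..b, f z ^ 2) * (s * s) +
      (2 * ∫ z in a..b, f z * g z) * s + ∫ z in a..b, g z ^ 2 := by
    intro s
    have hnn : 0 ≤ ∫ z in a..b, (s * f z + g z) ^ 2 :=
      integral_nonneg hab fun z _ => sq_nonneg _
    have hexp : ∫ z in a..b, (s * f z + g z) ^ 2 =
        ∫ z in a..b, (s * s * f z ^ 2 + 2 * s * (f z * g z) + g z ^ 2) :=
      integral_congr fun z _ => by ring
    rw [hexp, integral_add ((hff.const_mul _).add (hfg.const_mul _)) hgg,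
      integral_add (hff.const_mul _) (hfg.const_mul _), intervalIntegral.integral_const_mul,
      intervalIntegral.integral_const_mul] at hnn
    linarith
  have hdisc := discrim_le_zero hquad
  rw [discrim] at hdisc
  have hf0 : 0 ≤ ∫ z in a..b, f z ^ 2 := integral_nonneg hab fun z _ => sq_nonneg _
  rw [← Real.sqrt_mul hf0]
  apply Real.abs_le_sqrt
  linarith

/-- Poincaré inequality with constant `κ² < (π / l)²` for functions vanishing at both ends. -/
theorem sq_mul_integral_sq_le_integral_deriv_sq_of_lt {f f' : ℝ → ℝ} {l κ : ℝ} (hl : 0 < l)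
    (hκ : 0 < κ) (hκl : κ * l < π) (hf : ∀ z ∈ Icc 0 l, HasDerivAt f (f' z) z)
    (hf' : ContinuousOn f' (Icc 0 l)) (h0 : f 0 = 0) (h1 : f l = 0) :
    κ ^ 2 * ∫ z in (0:ℝ)..l, f z ^ 2 ≤ ∫ z in (0:ℝ)..l, f' z ^ 2 := by
  have hfc : ContinuousOn f (Icc 0 l) := fun z hz => (hf z hz).continuousAt.continuousWithinAt
  have hcos : ∀ z ∈ Icc 0 l, cos (κ * (z - l / 2)) ≠ 0 := fun z hz =>
    (cos_pos_of_mem_Ioo ⟨by nlinarith [mul_nonneg hκ.le hz.1],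
      by nlinarith [mul_le_mul_of_nonneg_left hz.2 hκ.le]⟩).ne'
  have htan : ∀ z ∈ Icc 0 l, HasDerivAt (fun w => tan (κ * (w - l / 2)))
      (κ * (1 + tan (κ * (z - l / 2)) ^ 2)) z := by
    intro z hz
    have hlin : HasDerivAt (fun w => κ * (w - l / 2)) κ z := by
      simpa using ((hasDerivAt_id z).sub_const (l / 2)).const_mul κ
    refine (HasDerivAt.comp z (Real.hasDerivAt_tan (hcos z hz)) hlin).congr_deriv ?_
    rw [one_div, ← inv_one_add_tan_sq (hcos z hz), inv_inv, mul_comm]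
  have htanc : ContinuousOn (fun w => tan (κ * (w - l / 2))) (Icc 0 l) :=
    fun z hz => (htan z hz).continuousAt.continuousWithinAt
  have hprim : ∀ z ∈ uIcc 0 l, HasDerivAt (fun w => κ * tan (κ * (w - l / 2)) * f w ^ 2)
      (κ * (κ * (1 + tan (κ * (z - l / 2)) ^ 2)) * f z ^ 2 +
        κ * tan (κ * (z - l / 2)) * (2 * f z * f' z)) z := by
    intro z hz
    rw [uIcc_of_le hl.le] at hz
    exact (((htan z hz).const_mul κ).mul ((hf z hz).pow 2)).congr_deriv (by simp)
  have hint : IntervalIntegrable (fun z => κ * (κ * (1 + tan (κ * (z - l / 2)) ^ 2)) * f z ^ 2 +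
        κ * tan (κ * (z - l / 2)) * (2 * f z * f' z)) volume 0 l :=
    ContinuousOn.intervalIntegrable_of_Icc hl.le (by fun_prop)
  have hzero := integral_eq_sub_of_hasDerivAt hprim hint
  simp only [h0, h1] at hzero
  have hff : IntervalIntegrable (fun z => f z ^ 2) volume 0 l :=
    (hfc.pow 2).intervalIntegrable_of_Icc hl.le
  have hff' : IntervalIntegrable (fun z => f' z ^ 2) volume 0 l :=
    (hf'.pow 2).intervalIntegrable_of_Icc hl.le
  have hnn : 0 ≤ ∫ z in (0:ℝ)..l, (f' z + κ * tan (κ * (z - l / 2)) * f z) ^ 2 :=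
    integral_nonneg hl.le fun z _ => sq_nonneg _
  have hexp : ∫ z in (0:ℝ)..l, (f' z + κ * tan (κ * (z - l / 2)) * f z) ^ 2 =
      ∫ z in (0:ℝ)..l, (f' z ^ 2 - κ ^ 2 * f z ^ 2 +
        (κ * (κ * (1 + tan (κ * (z - l / 2)) ^ 2)) * f z ^ 2 +
        κ * tan (κ * (z - l / 2)) * (2 * f z * f' z))) :=
    integral_congr fun z _ => by ring
  rw [hexp, integral_add (hff'.sub (hff.const_mul _)) hint, integral_sub hff' (hff.const_mul _),
    intervalIntegral.integral_const_mul, hzero] at hnn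
  linarith

/-- Poincaré inequality with the optimal constant for functions vanishing at both ends. -/
theorem pi_div_sq_mul_integral_sq_le_integral_deriv_sq {f f' : ℝ → ℝ} {l : ℝ} (hl : 0 < l)
    (hf : ∀ z ∈ Icc 0 l, HasDerivAt f (f' z) z)
    (hf' : ContinuousOn f' (Icc 0 l)) (h0 : f 0 = 0) (h1 : f l = 0) :
    (π / l) ^ 2 * ∫ z in (0:ℝ)..l, f z ^ 2 ≤ ∫ z in (0:ℝ)..l, f' z ^ 2 := by
  have hpos : 0 < π / l := div_pos pi_pos hl
  have hlim : Filter.Tendsto (fun κ : ℝ => κ ^ 2 * ∫ z in (0:ℝ)..l, f z ^ 2)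
      (nhdsWithin (π / l) (Iio (π / l))) (nhds ((π / l) ^ 2 * ∫ z in (0:ℝ)..l, f z ^ 2)) :=
    (Continuous.tendsto (by fun_prop) _).mono_left nhdsWithin_le_nhds
  refine le_of_tendsto hlim ?_
  filter_upwards [Ioo_mem_nhdsLT hpos] with κ hκ
  exact sq_mul_integral_sq_le_integral_deriv_sq_of_lt hl hκ.1 ((lt_div_iff₀ hl).1 hκ.2) hf hf' h0 h1

/-- Dirichlet form of the second derivative on functions vanishing at both ends. -/
theorem integral_mul_deriv_deriv_le {f f' f'' : ℝ → ℝ} {l : ℝ} (hl : 0 < l)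
    (hf : ∀ z ∈ Icc 0 l, HasDerivAt f (f' z) z) (hf' : ∀ z ∈ Icc 0 l, HasDerivAt f' (f'' z) z)
    (hf'' : ContinuousOn f'' (Icc 0 l)) (h0 : f 0 = 0) (h1 : f l = 0) :
    ∫ z in (0:ℝ)..l, f z * f'' z ≤ -((π / l) ^ 2 * ∫ z in (0:ℝ)..l, f z ^ 2) := by
  have hf'c : ContinuousOn f' (Icc 0 l) := fun z hz => (hf' z hz).continuousAt.continuousWithinAt
  rw [integral_mul_deriv_eq_deriv_mul (by rwa [uIcc_of_le hl.le]) (by rwa [uIcc_of_le hl.le])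
    (hf'c.intervalIntegrable_of_Icc hl.le) (hf''.intervalIntegrable_of_Icc hl.le), h0, h1]
  simp only [← sq]
  linarith [pi_div_sq_mul_integral_sq_le_integral_deriv_sq hl hf hf'c h0 h1]

/-- Differentiation under the integral sign in integrated form: the partial derivative `q` only
needs to be continuous in the space variable and bounded in `L¹`, uniformly in time. -/
theorem integral_sub_eq_integral_integral_of_hasDerivWithinAt {w q : ℝ → ℝ → ℝ} {l s t C : ℝ}
    (hl : 0 ≤ l) (hst : s ≤ t) (hq : ∀ τ ∈ Icc s t, ContinuousOn (fun z => q z τ) (Icc 0 l))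
    (hw : ∀ z ∈ Icc 0 l, ∀ τ ∈ Icc s t, HasDerivWithinAt (w z) (q z τ) (Icc s t) τ)
    (hC : ∀ τ ∈ Icc s t, ∫ z in (0:ℝ)..l, |q z τ| ≤ C) :
    IntervalIntegrable (fun τ => ∫ z in (0:ℝ)..l, q z τ) volume s t ∧
      ∫ z in (0:ℝ)..l, (w z t - w z s) = ∫ τ in s..t, ∫ z in (0:ℝ)..l, q z τ := by
  set P : ℝ → ℝ := fun z => projIcc 0 l hl z with hP
  have hPm : ∀ z, P z ∈ Icc 0 l := fun z => (projIcc 0 l hl z).2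
  have hPe : ∀ z ∈ Icc 0 l, P z = z := fun z hz => by simp [hP, projIcc_of_mem hl hz]
  have hPc : Continuous P := continuous_subtype_val.comp continuous_projIcc
  set Q : ℝ → ℝ → ℝ := fun z τ => (Ico s t).indicator (q (P z)) τ with hQ
  have hright : ∀ z ∈ Icc 0 l, ∀ τ ∈ Ico s t, HasDerivWithinAt (w z) (q z τ) (Ici τ) τ :=
    fun z hz τ hτ => (hw z hz τ (Ico_subset_Icc_self hτ)).mono_of_mem_nhdsWithin
      (Filter.mem_of_superset (Icc_mem_nhdsGE hτ.2) (Icc_subset_Icc_left hτ.1))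
  have hQmeas : Measurable (Function.uncurry Q) := by
    refine measurable_uncurry_of_continuous_of_measurable (fun τ => ?_) fun z => ?_
    · by_cases hτ : τ ∈ Ico s t
      · simp only [hQ, indicator_of_mem hτ]
        exact (hq τ (Ico_subset_Icc_self hτ)).comp_continuous hPc hPm
      · simp only [hQ, indicator_of_notMem hτ]
        exact continuous_const
    · have heq : Q z = (Ico s t).indicator fun τ => derivWithin (w (P z)) (Ici τ) τ :=
        indicator_congr fun τ hτ =>
          ((hright _ (hPm z) τ hτ).derivWithin (uniqueDiffWithinAt_Ici τ)).symm
      rw [heq]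
      exact (measurable_derivWithin_Ici _).indicator measurableSet_Ico
  have hQq : ∀ z ∈ Ioc 0 l, ∀ τ ∈ Ico s t, Q z τ = q z τ := fun z hz τ hτ => by
    simp only [hQ, indicator_of_mem hτ, hPe z (Ioc_subset_Icc_self hz)]
  have hC0 : 0 ≤ C := (integral_nonneg hl fun z _ => abs_nonneg (q z s)).trans
    (hC s (left_mem_Icc.2 hst))
  have hbound : ∀ τ, ∫ z in Ioc 0 l, ‖Q z τ‖ ≤ C := by
    intro τ
    by_cases hτ : τ ∈ Ico s t
    · rw [setIntegral_congr_fun (g := fun z => |q z τ|) measurableSet_Ioc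
        (fun z hz => by simp only [hQq z hz τ hτ, Real.norm_eq_abs]),
        ← integral_of_le hl]
      exact hC τ (Ico_subset_Icc_self hτ)
    · simpa [hQ, indicator_of_notMem hτ] using hC0
  have hint : Integrable (Function.uncurry Q)
      ((volume.restrict (Ioc 0 l)).prod (volume.restrict (Ioc s t))) := by
    rw [integrable_prod_iff' hQmeas.aestronglyMeasurable]
    refine ⟨Filter.Eventually.of_forall fun τ => ?_, ?_⟩
    · by_cases hτ : τ ∈ Ico s t
      · have hcont : Continuous fun z => q (P z) τ :=
          (hq τ (Ico_subset_Icc_self hτ)).comp_continuous hPc hPm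
        simp only [Function.uncurry, hQ, indicator_of_mem hτ]
        exact hcont.integrableOn_Ioc
      · simp [Function.uncurry, hQ, indicator_of_notMem hτ]
    · refine Integrable.mono' (integrable_const C)
        (hQmeas.norm.stronglyMeasurable.integral_prod_left (f := fun z τ => ‖Q z τ‖)
          |>.aestronglyMeasurable) (Filter.Eventually.of_forall fun τ => ?_)
      rw [Real.norm_of_nonneg (integral_nonneg fun _ => norm_nonneg _)]
      exact hbound τ
  have hne : ∀ᵐ τ ∂volume.restrict (Ioc s t), τ ∈ Ico s t := by
    filter_upwards [ae_restrict_mem measurableSet_Ioc,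
      ae_restrict_of_ae (Measure.ae_ne volume t)] with τ hτ hτt
    exact ⟨hτ.1.le, lt_of_le_of_ne hτ.2 hτt⟩
  have hinner : (fun τ => ∫ z in Ioc 0 l, Q z τ) =ᵐ[volume.restrict (Ioc s t)]
      fun τ => ∫ z in (0:ℝ)..l, q z τ := by
    filter_upwards [hne] with τ hτ
    rw [integral_of_le hl]
    exact setIntegral_congr_fun measurableSet_Ioc fun z hz => hQq z hz τ hτ
  refine ⟨?_, ?_⟩
  · rw [intervalIntegrable_iff_integrableOn_Ioc_of_le hst]
    exact hint.integral_prod_right.congr hinner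
  · rw [integral_of_le hst, ← integral_congr_ae hinner, ← integral_integral_swap hint,
      integral_of_le hl]
    refine integral_congr_ae ?_
    filter_upwards [hint.prod_right_ae, ae_restrict_mem measurableSet_Ioc] with z hzi hz
    have hz' := Ioc_subset_Icc_self hz
    rw [← integral_of_le hst, eq_comm]
    refine integral_eq_sub_of_hasDeriv_right_of_le hst
      (fun τ hτ => (hw z hz' τ hτ).continuousWithinAt) (fun τ hτ => ?_)
      ((intervalIntegrable_iff_integrableOn_Ioc_of_le hst).2 hzi)
    rw [hQq z hz τ (Ioo_subset_Ico_self hτ)]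
    exact (hright z hz' τ (Ioo_subset_Ico_self hτ)).mono Ioi_subset_Ici_self

/-- Grönwall inequality for a primitive of an integrable function. -/
theorem le_of_eq_add_integral_of_le_mul_add {V g : ℝ → ℝ} {s t m K : ℝ} (hst : s ≤ t) (hm : 0 < m)
    (hg : IntervalIntegrable g volume s t)
    (hV : ∀ τ ∈ Icc s t, V τ = V s + ∫ σ in s..τ, g σ)
    (hgV : ∀ τ ∈ Icc s t, g τ ≤ m * V τ + K) :
    V t ≤ V s * exp (m * (t - s)) + K / m * (exp (m * (t - s)) - 1) := by
  have hVc : ContinuousOn V (Icc s t) := by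
    have hprim := continuousOn_primitive_interval' hg left_mem_uIcc
    rw [uIcc_of_le hst] at hprim
    exact (continuousOn_const.add hprim).congr hV
  set P : ℝ → ℝ := fun z => projIcc s t hst z with hP
  have hPm : ∀ z, P z ∈ Icc s t := fun z => (projIcc s t hst z).2
  have hPe : ∀ z ∈ Icc s t, P z = z := fun z hz => by simp [hP, projIcc_of_mem hst hz]
  have hPc : Continuous P := continuous_subtype_val.comp continuous_projIcc
  have hWc : Continuous fun τ => m * V (P τ) + K :=
    ((hVc.comp_continuous hPc hPm).const_mul m).add_const K
  set U : ℝ → ℝ := fun τ => V s + ∫ σ in s..τ, (m * V (P σ) + K) with hU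
  have hUd : ∀ τ, HasDerivAt U (m * V (P τ) + K) τ := fun τ =>
    (hWc.integral_hasStrictDerivAt s τ).hasDerivAt.const_add _
  have hVU : ∀ τ ∈ Icc s t, V τ ≤ U τ := by
    intro τ hτ
    rw [hV τ hτ]
    refine add_le_add_right (integral_mono_on hτ.1
      (hg.mono_set (uIcc_subset_uIcc_left ?_)) (hWc.intervalIntegrable _ _) fun σ hσ => ?_) _
    · rwa [uIcc_of_le hst]
    · have hσ' : σ ∈ Icc s t := ⟨hσ.1, hσ.2.trans hτ.2⟩
      rw [hPe σ hσ']
      exact hgV σ hσ'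
  have hbound := le_gronwallBound_of_liminf_deriv_right_le (f := U)
    (f' := fun τ => m * V (P τ) + K) (δ := V s) (K := m) (ε := K) (a := s) (b := t)
    (fun τ _ => (hUd τ).continuousAt.continuousWithinAt)
    (fun τ _ r hr => by
      simpa [slope_def_field, div_eq_inv_mul] using
        (hUd τ).hasDerivWithinAt.liminf_right_slope_le hr)
    (by simp [hU]) (fun τ hτ => by
      have hτ' := Ico_subset_Icc_self hτ
      rw [hPe τ hτ']
      have := mul_le_mul_of_nonneg_left (hVU τ hτ') hm.le
      linarith) t (right_mem_Icc.2 hst)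
  rw [gronwallBound_of_K_ne_0 hm.ne'] at hbound
  exact (hVU t (right_mem_Icc.2 hst)).trans hbound

theorem le_lamMax2 (p q b : ℝ) : q ≤ lamMax2 p q b := by
  have habs : |p - q| ≤ √((p - q) ^ 2 + 4 * b ^ 2) :=
    Real.abs_le_sqrt (by nlinarith [sq_nonneg b])
  rw [lamMax2]
  linarith [neg_abs_le (p - q)]

theorem quadratic_form_le_lamMax2 (p q b X Y : ℝ) :
    p * X ^ 2 + 2 * b * (X * Y) + q * Y ^ 2 ≤ lamMax2 p q b * (X ^ 2 + Y ^ 2) := by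
  have hCS : (p - q) * (X ^ 2 - Y ^ 2) + 4 * b * (X * Y) ≤
      √((p - q) ^ 2 + 4 * b ^ 2) * (X ^ 2 + Y ^ 2) := by
    refine le_of_abs_le ?_
    rw [← Real.sqrt_sq (by positivity : 0 ≤ X ^ 2 + Y ^ 2), ← Real.sqrt_mul (by positivity)]
    refine Real.abs_le_sqrt ?_
    nlinarith [sq_nonneg ((p - q) * (2 * X * Y) - 2 * b * (X ^ 2 - Y ^ 2))]
  rw [lamMax2]
  linarith

/-- Bound on the energy production rate `2 ∫ u uₜ + 2 y yₜ` at a fixed time. -/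
theorem energy_rate_le {l a c ε y e δ : ℝ} {Φ B D u u' u'' d : ℝ → ℝ} (hl : 0 < l) (hε : 0 < ε)
    (hΦc : Continuous Φ) (hΦ : ∀ s, s * Φ s ≤ 0)
    (hB : ContinuousOn B (Icc 0 l)) (hD : ContinuousOn D (Icc 0 l))
    (hd : ContinuousOn d (Icc 0 l)) (hu : ∀ z ∈ Icc 0 l, HasDerivAt u (u' z) z)
    (hu' : ∀ z ∈ Icc 0 l, HasDerivAt u' (u'' z) z) (hu'' : ContinuousOn u'' (Icc 0 l))
    (h0 : u 0 = 0) (h1 : u l = 0) (hδ : √((∫ z in (0:ℝ)..l, d z ^ 2) + e ^ 2) ≤ δ) :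
    ∫ z in (0:ℝ)..l, (2 * (u z * (a ^ 2 * u'' z + Φ (u z) + B z * y + d z)) +
        2 * (y * (c ^ 2 * y + (∫ z in (0:ℝ)..l, D z * u z) + e)) / l) ≤
      (lamMax2 (-2 * π ^ 2 * a ^ 2 / l ^ 2) (2 * c ^ 2) (L2norm l fun z => B z + D z) + ε) *
        ((∫ z in (0:ℝ)..l, u z ^ 2) + y ^ 2) + δ ^ 2 / ε := by
  have huc : ContinuousOn u (Icc 0 l) := fun z hz => (hu z hz).continuousAt.continuousWithinAt
  have hintegrable : ∀ {f : ℝ → ℝ}, ContinuousOn f (Icc 0 l) → IntervalIntegrable f volume 0 l :=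
    fun hf => hf.intervalIntegrable_of_Icc hl.le
  have iuu : IntervalIntegrable (fun z => u z * u'' z) volume 0 l := hintegrable (huc.mul hu'')
  have iΦ : IntervalIntegrable (fun z => u z * Φ (u z)) volume 0 l :=
    hintegrable (huc.mul (hΦc.comp_continuousOn huc))
  have iB : IntervalIntegrable (fun z => B z * u z) volume 0 l := hintegrable (hB.mul huc)
  have iD : IntervalIntegrable (fun z => D z * u z) volume 0 l := hintegrable (hD.mul huc)
  have id' : IntervalIntegrable (fun z => u z * d z) volume 0 l := hintegrable (huc.mul hd)
  set J := ∫ z in (0:ℝ)..l, D z * u z with hJ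
  have hexp : ∫ z in (0:ℝ)..l, (2 * (u z * (a ^ 2 * u'' z + Φ (u z) + B z * y + d z)) +
        2 * (y * (c ^ 2 * y + J + e)) / l) =
      2 * a ^ 2 * (∫ z in (0:ℝ)..l, u z * u'' z) + 2 * (∫ z in (0:ℝ)..l, u z * Φ (u z)) +
        2 * y * (∫ z in (0:ℝ)..l, B z * u z) + 2 * (∫ z in (0:ℝ)..l, u z * d z) +
        2 * (y * (c ^ 2 * y + J + e)) := by
    rw [integral_congr (g := fun z => 2 * a ^ 2 * (u z * u'' z) + 2 * (u z * Φ (u z)) +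
        2 * y * (B z * u z) + 2 * (u z * d z) + 2 * (y * (c ^ 2 * y + J + e)) / l)
        (fun z _ => by ring),
      integral_add ((((iuu.const_mul _).add (iΦ.const_mul _)).add (iB.const_mul _)).add
        (id'.const_mul _)) intervalIntegrable_const,
      integral_add (((iuu.const_mul _).add (iΦ.const_mul _)).add (iB.const_mul _))
        (id'.const_mul _),
      integral_add ((iuu.const_mul _).add (iΦ.const_mul _)) (iB.const_mul _),
      integral_add (iuu.const_mul _) (iΦ.const_mul _)]
    simp only [intervalIntegral.integral_const_mul, intervalIntegral.integral_const, smul_eq_mul, sub_zero]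
    rw [mul_div_cancel₀ _ hl.ne']
  rw [hexp]
  have hdiff := integral_mul_deriv_deriv_le hl hu hu' hu'' h0 h1
  have hreact : ∫ z in (0:ℝ)..l, u z * Φ (u z) ≤ 0 :=
    (integral_mono_on hl.le iΦ intervalIntegrable_const fun z _ => hΦ (u z)).trans_eq (by simp)
  have hcouple := abs_integral_mul_le_sqrt_mul_sqrt (f := fun z => B z + D z) hl.le
    (hB.add hD) huc
  rw [integral_congr (g := fun z => B z * u z + D z * u z) (fun z _ => by ring),
    integral_add iB iD, ← hJ] at hcouple
  have hdist := (le_abs_self _).trans (abs_integral_mul_le_sqrt_mul_sqrt hl.le huc hd)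
  have hu0 : 0 ≤ ∫ z in (0:ℝ)..l, u z ^ 2 := integral_nonneg hl.le fun z _ => sq_nonneg _
  have hd0 : 0 ≤ ∫ z in (0:ℝ)..l, d z ^ 2 := integral_nonneg hl.le fun z _ => sq_nonneg _
  have hδsq : (∫ z in (0:ℝ)..l, d z ^ 2) + e ^ 2 ≤ δ ^ 2 :=
    (Real.sqrt_le_left ((Real.sqrt_nonneg _).trans hδ)).1 hδ
  have hform := quadratic_form_le_lamMax2 (-2 * π ^ 2 * a ^ 2 / l ^ 2) (2 * c ^ 2)
    (L2norm l fun z => B z + D z) (√(∫ z in (0:ℝ)..l, u z ^ 2)) |y|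
  change _ ≤ L2norm l (fun z => B z + D z) * _ at hcouple
  rw [sq_abs, Real.sq_sqrt hu0] at hform
  have hdu := Real.sq_sqrt hu0
  have hdd := Real.sq_sqrt hd0
  set X := √(∫ z in (0:ℝ)..l, u z ^ 2)
  set N := L2norm l fun z => B z + D z
  set E := √(∫ z in (0:ℝ)..l, d z ^ 2)
  set IB := ∫ z in (0:ℝ)..l, B z * u z
  have hcouple' : y * (IB + J) ≤ N * (X * |y|) :=
    calc y * (IB + J) ≤ |y| * |IB + J| := by rw [← abs_mul]; exact le_abs_self _
      _ ≤ |y| * (N * X) := mul_le_mul_of_nonneg_left hcouple (abs_nonneg y)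
      _ = N * (X * |y|) := by ring
  have hdiff' := mul_le_mul_of_nonneg_left hdiff (by positivity : 0 ≤ 2 * a ^ 2)
  have hcoef : 2 * a ^ 2 * -((π / l) ^ 2 * ∫ z in (0:ℝ)..l, u z ^ 2) =
      -2 * π ^ 2 * a ^ 2 / l ^ 2 * ∫ z in (0:ℝ)..l, u z ^ 2 := by
    field_simp
  have hyoung : 2 * (X * E) + 2 * (y * e) ≤ ε * (X ^ 2 + y ^ 2) + δ ^ 2 / ε := by
    have hsq : ε * (X ^ 2 + y ^ 2) + (E ^ 2 + e ^ 2) / ε - (2 * (X * E) + 2 * (y * e)) =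
        ((ε * X - E) ^ 2 + (ε * y - e) ^ 2) / ε := by
      field_simp
      ring
    have hnn : 0 ≤ ((ε * X - E) ^ 2 + (ε * y - e) ^ 2) / ε := by positivity
    have hle : (E ^ 2 + e ^ 2) / ε ≤ δ ^ 2 / ε := by
      rw [hdd]
      exact div_le_div_of_nonneg_right hδsq hε.le
    linarith
  rw [hdu] at hyoung
  linarith

end

/-- Corollary 1: a priori bound for classical solutions of the coupled
ODE–PDE system on `[t₀, t₀+T)`:
`(‖x(·,t)‖²_{L²} + y(t)²)^{1/2}
   ≤ e^{λT/2}(‖x(·,t₀)‖²_{L²} + y(t₀)²)^{1/2} + ((e^{λT} − 1)/(ελ))^{1/2}·𝔡`,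
where `λ = λ_max(Ã₀) + ε` and `Ã₀` has diagonal `−2π²a²/l², 2c²` and off-diagonal
`‖B+D‖_{L²}`. -/
theorem stmt6 (l a c : ℝ) (hl : 0 < l) (ha : 0 < a) (hc : 0 < c)
    (Φ : ℝ → ℝ) (hΦcont : Continuous Φ) (hΦ : ∀ s : ℝ, s * Φ s ≤ 0)
    (B D : ℝ → ℝ) (hB : ContinuousOn B (Icc 0 l)) (hD : ContinuousOn D (Icc 0 l))
    (ε : ℝ) (hε : 0 < ε)
    (t₀ T : ℝ) (hT : 0 < T)
    (x xz xzz : ℝ → ℝ → ℝ) (y : ℝ → ℝ)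
    (d11 : ℝ → ℝ → ℝ) (d12 : ℝ → ℝ)
    -- regularity of the classical solution
    (hbc : ∀ t ∈ Ico t₀ (t₀ + T), x 0 t = 0 ∧ x l t = 0)
    (hz : ∀ t ∈ Ico t₀ (t₀ + T), ∀ z ∈ Icc (0:ℝ) l, HasDerivAt (fun w => x w t) (xz z t) z)
    (hzz : ∀ t ∈ Ico t₀ (t₀ + T), ∀ z ∈ Icc (0:ℝ) l, HasDerivAt (fun w => xz w t) (xzz z t) z)
    (hzzc : ContinuousOn (fun p : ℝ × ℝ => xzz p.1 p.2) (Icc 0 l ×ˢ Ico t₀ (t₀ + T)))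
    (hxc : ContinuousOn (fun p : ℝ × ℝ => x p.1 p.2) (Icc 0 l ×ˢ Ico t₀ (t₀ + T)))
    (hd11c : ∀ t ∈ Ico t₀ (t₀ + T), ContinuousOn (fun z => d11 z t) (Icc 0 l))
    -- the PDE and the ODE
    (hpde : ∀ z ∈ Icc (0:ℝ) l, ∀ t ∈ Ico t₀ (t₀ + T),
      HasDerivWithinAt (fun s => x z s)
        (a^2 * xzz z t + Φ (x z t) + B z * y t + d11 z t) (Ico t₀ (t₀ + T)) t)
    (hode : ∀ t ∈ Ico t₀ (t₀ + T),
      HasDerivWithinAt y (c^2 * y t + (∫ z in (0:ℝ)..l, D z * x z t) + d12 t)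
        (Ico t₀ (t₀ + T)) t)
    -- bound on the disturbances
    (𝔡 : ℝ)
    (h𝔡 : ∀ t ∈ Ico t₀ (t₀ + T),
      Real.sqrt ((∫ z in (0:ℝ)..l, (d11 z t)^2) + (d12 t)^2) ≤ 𝔡)
    -- λ = λ_max(Ã₀) + ε
    (lam : ℝ)
    (hlam : lam = lamMax2 (-2 * π^2 * a^2 / l^2) (2 * c^2)
      (L2norm l (fun z => B z + D z)) + ε) :
    ∀ t ∈ Ico t₀ (t₀ + T),
      Real.sqrt ((∫ z in (0:ℝ)..l, (x z t)^2) + (y t)^2) ≤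
        Real.exp (lam * T / 2) * Real.sqrt ((∫ z in (0:ℝ)..l, (x z t₀)^2) + (y t₀)^2) +
          Real.sqrt ((Real.exp (lam * T) - 1) / (ε * lam)) * 𝔡 := by

  intro t₁ ht₁
  have hsub : Icc t₀ t₁ ⊆ Ico t₀ (t₀ + T) := fun τ hτ => ⟨hτ.1, hτ.2.trans_lt ht₁.2⟩
  have h𝔡0 : 0 ≤ 𝔡 := (Real.sqrt_nonneg _).trans (h𝔡 t₁ ht₁)
  have hd0 : ∀ τ, 0 ≤ ∫ z in (0:ℝ)..l, d11 z τ ^ 2 := fun τ =>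
    intervalIntegral.integral_nonneg hl.le fun z _ => sq_nonneg _
  have h𝔡sq : ∀ τ ∈ Icc t₀ t₁, (∫ z in (0:ℝ)..l, d11 z τ ^ 2) + d12 τ ^ 2 ≤ 𝔡 ^ 2 :=
    fun τ hτ => (Real.sqrt_le_left h𝔡0).1 (h𝔡 τ (hsub hτ))
  have hslice : ∀ τ ∈ Ico t₀ (t₀ + T), MapsTo (fun z : ℝ => (z, τ)) (Icc 0 l)
      (Icc 0 l ×ˢ Ico t₀ (t₀ + T)) := fun τ hτ z hz => ⟨hz, hτ⟩
  have hxτ : ∀ τ ∈ Icc t₀ t₁, ContinuousOn (fun z => x z τ) (Icc 0 l) := fun τ hτ =>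
    hxc.comp (f := fun z : ℝ => (z, τ)) (by fun_prop) (hslice τ (hsub hτ))
  have hzzτ : ∀ τ ∈ Icc t₀ t₁, ContinuousOn (fun z => xzz z τ) (Icc 0 l) := fun τ hτ =>
    hzzc.comp (f := fun z : ℝ => (z, τ)) (by fun_prop) (hslice τ (hsub hτ))
  have hyc : ContinuousOn y (Icc t₀ t₁) := fun τ hτ =>
    ((hode τ (hsub hτ)).mono hsub).continuousWithinAt
  -- the energy density, with the energy of `y` spread uniformly over `[0, l]`, and its rate
  set w : ℝ → ℝ → ℝ := fun z τ => x z τ ^ 2 + y τ ^ 2 / l with hw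
  set q : ℝ → ℝ → ℝ := fun z τ =>
    2 * (x z τ * (a ^ 2 * xzz z τ + Φ (x z τ) + B z * y τ + d11 z τ)) +
      2 * (y τ * (c ^ 2 * y τ + (∫ z in (0:ℝ)..l, D z * x z τ) + d12 τ)) / l with hq
  have hqc : ∀ τ ∈ Icc t₀ t₁, ContinuousOn (fun z => q z τ) (Icc 0 l) := by
    intro τ hτ
    have hx' := hxτ τ hτ
    have hΦx : ContinuousOn (fun z => Φ (x z τ)) (Icc 0 l) := hΦcont.comp_continuousOn hx'
    have hzz' := hzzτ τ hτ
    have hd' := hd11c τ (hsub hτ)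
    simp only [hq]
    fun_prop
  have hwd : ∀ z ∈ Icc 0 l, ∀ τ ∈ Icc t₀ t₁,
      HasDerivWithinAt (w z) (q z τ) (Icc t₀ t₁) τ := by
    intro z hz τ hτ
    have hxd := ((hpde z hz τ (hsub hτ)).mono hsub).pow 2
    have hyd := (((hode τ (hsub hτ)).mono hsub).pow 2).div_const l
    refine (hxd.add hyd).congr_deriv ?_
    simp only [hq]
    ring
  obtain ⟨C, hC⟩ : ∃ C, ∀ τ ∈ Icc t₀ t₁, ∫ z in (0:ℝ)..l, |q z τ| ≤ C := by
    have hK : IsCompact (Icc 0 l ×ˢ Icc t₀ t₁) := isCompact_Icc.prod isCompact_Icc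
    have hKsub : Icc 0 l ×ˢ Icc t₀ t₁ ⊆ Icc 0 l ×ˢ Ico t₀ (t₀ + T) := prod_mono_right hsub
    have hxK := hxc.mono hKsub
    have hzzK := hzzc.mono hKsub
    have hΦK : ContinuousOn (fun p : ℝ × ℝ => Φ (x p.1 p.2)) (Icc 0 l ×ˢ Icc t₀ t₁) :=
      hΦcont.comp_continuousOn hxK
    have hBK : ContinuousOn (fun p : ℝ × ℝ => B p.1) (Icc 0 l ×ˢ Icc t₀ t₁) :=
      hB.comp continuousOn_fst fun p hp => hp.1
    have hDK : ContinuousOn (fun p : ℝ × ℝ => D p.1) (Icc 0 l ×ˢ Icc t₀ t₁) :=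
      hD.comp continuousOn_fst fun p hp => hp.1
    have hyK : ContinuousOn (fun p : ℝ × ℝ => y p.2) (Icc 0 l ×ˢ Icc t₀ t₁) :=
      hyc.comp continuousOn_snd fun p hp => hp.2
    obtain ⟨M, hM⟩ := hK.exists_bound_of_continuousOn hxK
    obtain ⟨R, hR⟩ := hK.exists_bound_of_continuousOn
      (((hzzK.const_mul (a ^ 2)).add hΦK).add (hBK.mul hyK))
    obtain ⟨S, hS⟩ := hK.exists_bound_of_continuousOn (hDK.mul hxK)
    obtain ⟨Y, hY⟩ := isCompact_Icc.exists_bound_of_continuousOn hyc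
    refine ⟨2 * (M * (R + 1)) * l + 2 * M * 𝔡 ^ 2 + 2 * (Y * (c ^ 2 * Y + S * l + 𝔡)),
      fun τ hτ => ?_⟩
    have h0l : (0:ℝ) ∈ Icc 0 l := left_mem_Icc.2 hl.le
    have hM0 : 0 ≤ M := (norm_nonneg _).trans (hM (0, τ) ⟨h0l, hτ⟩)
    have hY0 : 0 ≤ Y := (norm_nonneg _).trans (hY τ hτ)
    have hDx : |∫ z in (0:ℝ)..l, D z * x z τ| ≤ S * l := by
      have := intervalIntegral.norm_integral_le_of_norm_le_const (a := 0) (b := l) (C := S)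
        (f := fun z => D z * x z τ) fun z hz => by
          rw [uIoc_of_le hl.le] at hz
          exact hS (z, τ) ⟨Ioc_subset_Icc_self hz, hτ⟩
      simpa [abs_of_pos hl] using this
    have hd12 : |d12 τ| ≤ 𝔡 := abs_le_of_sq_le_sq (by linarith [h𝔡sq τ hτ, hd0 τ]) h𝔡0
    have hode_le : |y τ * (c ^ 2 * y τ + (∫ z in (0:ℝ)..l, D z * x z τ) + d12 τ)| ≤
        Y * (c ^ 2 * Y + S * l + 𝔡) := by
      have hYτ : |y τ| ≤ Y := hY τ hτ
      rw [abs_mul]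
      refine mul_le_mul hYτ ?_ (abs_nonneg _) hY0
      refine (abs_add_three _ _ _).trans (add_le_add (add_le_add ?_ hDx) hd12)
      rw [abs_mul, abs_of_nonneg (sq_nonneg c)]
      gcongr
    have hpt : ∀ z ∈ Icc 0 l, |q z τ| ≤ 2 * (M * (R + 1)) + 2 * M * d11 z τ ^ 2 +
        2 * (Y * (c ^ 2 * Y + S * l + 𝔡)) / l := by
      intro z hz
      have hMz : |x z τ| ≤ M := hM (z, τ) ⟨hz, hτ⟩
      have hRz : |a ^ 2 * xzz z τ + Φ (x z τ) + B z * y τ| ≤ R := hR (z, τ) ⟨hz, hτ⟩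
      have hdz : |d11 z τ| ≤ 1 + d11 z τ ^ 2 := by
        nlinarith [sq_abs (d11 z τ), sq_nonneg (|d11 z τ| - 1), abs_nonneg (d11 z τ)]
      have hpde_le : |x z τ * (a ^ 2 * xzz z τ + Φ (x z τ) + B z * y τ + d11 z τ)| ≤
          M * (R + (1 + d11 z τ ^ 2)) := by
        rw [abs_mul]
        exact mul_le_mul hMz ((abs_add_le _ _).trans (add_le_add hRz hdz)) (abs_nonneg _) hM0
      refine (abs_add_le _ _).trans ?_
      rw [abs_div, abs_of_pos hl, abs_mul, abs_mul 2 (y τ * _), abs_two]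
      have hdiv : 2 * |y τ * (c ^ 2 * y τ + (∫ z in (0:ℝ)..l, D z * x z τ) + d12 τ)| / l ≤
          2 * (Y * (c ^ 2 * Y + S * l + 𝔡)) / l := by gcongr
      linarith
    have hdint : IntervalIntegrable (fun z => d11 z τ ^ 2) MeasureTheory.volume 0 l :=
      ((hd11c τ (hsub hτ)).pow 2).intervalIntegrable_of_Icc hl.le
    refine (intervalIntegral.integral_mono_on hl.le
      ((hqc τ hτ).abs.intervalIntegrable_of_Icc hl.le)
      ((intervalIntegrable_const.add (hdint.const_mul _)).add intervalIntegrable_const)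
      hpt).trans ?_
    rw [intervalIntegral.integral_add (intervalIntegrable_const.add (hdint.const_mul _))
      intervalIntegrable_const, intervalIntegral.integral_add intervalIntegrable_const
      (hdint.const_mul _)]
    simp only [intervalIntegral.integral_const_mul, intervalIntegral.integral_const, smul_eq_mul,
      sub_zero]
    rw [mul_div_cancel₀ _ hl.ne']
    have hd2 : ∫ z in (0:ℝ)..l, d11 z τ ^ 2 ≤ 𝔡 ^ 2 := by
      linarith [h𝔡sq τ hτ, sq_nonneg (d12 τ)]
    linarith [mul_le_mul_of_nonneg_left hd2 (mul_nonneg zero_le_two hM0)]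
  have hflux : ∀ τ ∈ Icc t₀ t₁,
      IntervalIntegrable (fun σ => ∫ z in (0:ℝ)..l, q z σ) MeasureTheory.volume t₀ τ ∧
        ∫ z in (0:ℝ)..l, (w z τ - w z t₀) = ∫ σ in t₀..τ, ∫ z in (0:ℝ)..l, q z σ := by
    intro τ hτ
    have hsub' : Icc t₀ τ ⊆ Icc t₀ t₁ := Icc_subset_Icc_right hτ.2
    exact integral_sub_eq_integral_integral_of_hasDerivWithinAt hl.le hτ.1
      (fun σ hσ => hqc σ (hsub' hσ))
      (fun z hz σ hσ => (hwd z hz σ (hsub' hσ)).mono hsub') fun σ hσ => hC σ (hsub' hσ)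
  have henergy : ∀ τ ∈ Icc t₀ t₁, (∫ z in (0:ℝ)..l, x z τ ^ 2) + y τ ^ 2 =
      (∫ z in (0:ℝ)..l, x z t₀ ^ 2) + y t₀ ^ 2 +
        ∫ σ in t₀..τ, ∫ z in (0:ℝ)..l, q z σ := by
    intro τ hτ
    have hsq : ∀ σ ∈ Icc t₀ t₁,
        IntervalIntegrable (fun z => x z σ ^ 2) MeasureTheory.volume 0 l := fun σ hσ =>
      ((hxτ σ hσ).pow 2).intervalIntegrable_of_Icc hl.le
    have hτ₀ := left_mem_Icc.2 (hτ.1.trans hτ.2)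
    rw [← (hflux τ hτ).2]
    simp only [hw]
    rw [intervalIntegral.integral_sub ((hsq τ hτ).add intervalIntegrable_const)
        ((hsq t₀ hτ₀).add intervalIntegrable_const),
      intervalIntegral.integral_add (hsq τ hτ) intervalIntegrable_const,
      intervalIntegral.integral_add (hsq t₀ hτ₀) intervalIntegrable_const]
    simp only [intervalIntegral.integral_const, smul_eq_mul, sub_zero]
    rw [mul_div_cancel₀ _ hl.ne', mul_div_cancel₀ _ hl.ne']
    ring
  have hlam0 : 0 < lam := by
    have := le_lamMax2 (-2 * π^2 * a^2 / l^2) (2 * c^2) (L2norm l (fun z => B z + D z))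
    rw [hlam]
    linarith [pow_pos hc 2]
  have hgron := le_of_eq_add_integral_of_le_mul_add
    (V := fun τ => (∫ z in (0:ℝ)..l, x z τ ^ 2) + y τ ^ 2) (m := lam) (K := 𝔡 ^ 2 / ε)
    ht₁.1 hlam0 (hflux t₁ (right_mem_Icc.2 ht₁.1)).1 henergy fun τ hτ => by
      rw [hlam]
      exact energy_rate_le hl hε hΦcont hΦ hB hD (hd11c τ (hsub hτ)) (hz τ (hsub hτ))
        (hzz τ (hsub hτ)) (hzzτ τ hτ) (hbc τ (hsub hτ)).1 (hbc τ (hsub hτ)).2 (h𝔡 τ (hsub hτ))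
  have hV0 : 0 ≤ (∫ z in (0:ℝ)..l, x z t₀ ^ 2) + y t₀ ^ 2 :=
    add_nonneg (intervalIntegral.integral_nonneg hl.le fun z _ => sq_nonneg _) (sq_nonneg _)
  have hexp : exp (lam * (t₁ - t₀)) ≤ exp (lam * T) :=
    exp_le_exp.2 (mul_le_mul_of_nonneg_left (by linarith [ht₁.2]) hlam0.le)
  have hexp1 : 0 ≤ exp (lam * T) - 1 := by
    linarith [one_le_exp (mul_nonneg hlam0.le hT.le)]
  have hbound : (∫ z in (0:ℝ)..l, x z t₁ ^ 2) + y t₁ ^ 2 ≤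
      exp (lam * T / 2) ^ 2 * ((∫ z in (0:ℝ)..l, x z t₀ ^ 2) + y t₀ ^ 2) +
        (exp (lam * T) - 1) / (ε * lam) * 𝔡 ^ 2 := by
    have hsplit : exp (lam * T / 2) ^ 2 = exp (lam * T) := by
      rw [sq, ← exp_add, add_halves]
    rw [hsplit]
    refine hgron.trans ?_
    have hcoef : (exp (lam * T) - 1) / (ε * lam) * 𝔡 ^ 2 =
        𝔡 ^ 2 / ε / lam * (exp (lam * T) - 1) := by
      field_simp
    rw [hcoef, mul_comm]
    gcongr
  refine Real.sqrt_le_iff.2 ⟨by positivity, hbound.trans ?_⟩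
  have hcross : 0 ≤ exp (lam * T / 2) * √((∫ z in (0:ℝ)..l, x z t₀ ^ 2) + y t₀ ^ 2) *
      (√((exp (lam * T) - 1) / (ε * lam)) * 𝔡) := by positivity
  rw [add_sq, mul_pow, mul_pow, Real.sq_sqrt hV0, Real.sq_sqrt (by positivity)]
  linarith
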